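/- Let a = (β,m) be a simple affine root, i.e. either a = (β,0) with β a simple root of Σ₀, or a = (−φ,1) where φ is the highest root (note −φ ∈ Σ₀). Then for every function f that is smooth on V_reg, every u ∈ V and every v ∈ V_reg (so also s_a(v) ∈ V_reg), the Dunkl-type operators satisfy the cross relation (D_u^k f)(s_a(v)) = (D_{u − β(u)β∨}^k (f ∘ s_a))(v) + k_β·β(u)·f(v). -/

import Mathlib

open scoped BigOperators
open RealInnerProductSpace

noncomputable section

/-- The coroot `α∨` of a root `α`, under the identification of `V*` with `V`
via the inner product: `ξ(α∨) = 2⟨ξ,α⟩/‖α‖²`. -/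
def coroot {V : Type*} [NormedAddCommGroup V] [InnerProductSpace ℝ V] (α : V) : V :=
  (2 / ‖α‖ ^ 2) • α

/-- The orthogonal reflection `s_α` in the hyperplane orthogonal to `α`:
`s_α(ξ) = ξ − ξ(α∨)·α = ξ − α(ξ)·α∨`. -/
def sRefl {V : Type*} [NormedAddCommGroup V] [InnerProductSpace ℝ V] (α v : V) : V :=
  v - ⟪α, v⟫ • coroot α

/-- A finite, irreducible, reduced, crystallographic root system `Σ₀` in the dual of
the Euclidean space `V` (identified with `V` via the inner product), together with a
fixed base of simple roots, the positive roots, and the highest root. -/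
structure RootSystemBase (V : Type*) [NormedAddCommGroup V] [InnerProductSpace ℝ V]
    [FiniteDimensional ℝ V] where
  roots : Finset V
  roots_nonempty : roots.Nonempty
  ne_zero : ∀ α ∈ roots, α ≠ (0 : V)
  /-- reduced -/
  reduced : ∀ α ∈ roots, ∀ c : ℝ, c • α ∈ roots → c = 1 ∨ c = -1
  /-- crystallographic: `β(α∨) ∈ ℤ` -/
  crystallographic : ∀ α ∈ roots, ∀ β ∈ roots, ∃ m : ℤ, ⟪β, coroot α⟫ = (m : ℝ)
  /-- stable under the reflections `s_α` -/
  refl_mem : ∀ α ∈ roots, ∀ β ∈ roots, sRefl α β ∈ roots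
  /-- `Σ₀` spans `V*` -/
  spanning : Submodule.span ℝ (roots : Set V) = ⊤
  /-- irreducible: no nontrivial orthogonal decomposition -/
  irreducible : ∀ s : Finset V, s ⊆ roots →
    (∀ α ∈ s, ∀ β ∈ roots, β ∉ s → ⟪α, β⟫ = 0) → s = ∅ ∨ s = roots
  /-- the fixed base of simple roots -/
  simples : Finset V
  simples_sub : simples ⊆ roots
  simples_indep : LinearIndependent ℝ (fun β : {x // x ∈ simples} => (β : V))
  /-- the positive roots w.r.t. the base -/
  pos : Finset V
  pos_sub : pos ⊆ roots
  simples_sub_pos : simples ⊆ pos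
  pos_or_neg : ∀ α ∈ roots, (α ∈ pos ∧ -α ∉ pos) ∨ (α ∉ pos ∧ -α ∈ pos)
  pos_combo : ∀ α ∈ pos, ∃ c : V → ℝ, (∀ β, 0 ≤ c β) ∧ α = ∑ β ∈ simples, c β • β
  /-- the highest root `φ` -/
  hroot : V
  hroot_pos : hroot ∈ pos
  hroot_highest : ∀ α ∈ roots, ∃ c : V → ℝ, (∀ β, 0 ≤ c β) ∧
    hroot - α = ∑ β ∈ simples, c β • β

variable {V : Type*} [NormedAddCommGroup V] [InnerProductSpace ℝ V] [FiniteDimensional ℝ V]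

/-- The Weyl group `W₀`: the subgroup of linear automorphisms of `V` generated by the
orthogonal reflections in the roots. -/
def weylGroup (R : RootSystemBase V) : Subgroup (V ≃ₗ[ℝ] V) :=
  Subgroup.closure {w : V ≃ₗ[ℝ] V | ∃ α ∈ R.roots, ∀ v, w v = sRefl α v}

/-- A strictly positive `W₀`-invariant multiplicity function. -/
def IsMultiplicity (R : RootSystemBase V) (k : V → ℝ) : Prop :=
  (∀ α ∈ R.roots, 0 < k α) ∧
  (∀ w : V ≃ₗ[ℝ] V, w ∈ weylGroup R → ∀ α ∈ R.roots, k (w α) = k α)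

/-- `σ_η^k = Σ_{α∈Σ₀} arctan(η(α∨)/k_α)·α`. -/
def sigmaFun (R : RootSystemBase V) (k : V → ℝ) (η : V) : V :=
  ∑ α ∈ R.roots, Real.arctan (⟪η, coroot α⟫ / k α) • α

/-- The master function
`S_k(μ,ξ) = ½‖ξ‖² − 2π⟨μ,ξ⟩ + ½ Σ_{α∈Σ₀} ‖α‖² ∫₀^{ξ(α∨)} arctan(t/k_α) dt`. -/
def masterFun (R : RootSystemBase V) (k : V → ℝ) (μ ξ : V) : ℝ :=
  ‖ξ‖ ^ 2 / 2 - 2 * Real.pi * ⟪μ, ξ⟫ +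
    (1 / 2) * ∑ α ∈ R.roots, ‖α‖ ^ 2 * ∫ t in (0:ℝ)..(⟪ξ, coroot α⟫), Real.arctan (t / k α)

/-- Membership in the weight lattice `P = {λ ∈ V* : λ(α∨) ∈ ℤ ∀α ∈ Σ₀}`. -/
def IsWeight (R : RootSystemBase V) (lam : V) : Prop :=
  ∀ α ∈ R.roots, ∃ m : ℤ, ⟪lam, coroot α⟫ = (m : ℝ)

/-- `η ∈ V*` is a Bethe root: `λ = iη` solves the Bethe ansatz equations
`e^{(wλ)(φ∨)} = ∏_{α∈Σ₀⁺} ((wλ)(α∨) − k_α)/((wλ)(α∨) + k_α))^{α(φ∨)}` for all `w ∈ W₀`,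
where `m α = α(φ∨) ∈ ℤ≥0`. -/
def IsBetheRoot (R : RootSystemBase V) (k : V → ℝ) (m : V → ℕ) (η : V) : Prop :=
  ∀ w : V ≃ₗ[ℝ] V, w ∈ weylGroup R →
    Complex.exp (Complex.I * (⟪w η, coroot R.hroot⟫ : ℝ)) =
      ∏ α ∈ R.pos,
        ((Complex.I * (⟪w η, coroot α⟫ : ℝ) - (k α : ℂ)) /
         (Complex.I * (⟪w η, coroot α⟫ : ℝ) + (k α : ℂ))) ^ (m α)

end

noncomputable section

/-- The set of regular vectors: the complement of the union of all affine root
hyperplanes `{v : α(v) + m = 0}` (`α ∈ Σ₀`, `m ∈ ℤ`). -/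
def VregSet {V : Type*} [NormedAddCommGroup V] [InnerProductSpace ℝ V]
    [FiniteDimensional ℝ V] (R : RootSystemBase V) : Set V :=
  {v : V | ∀ α ∈ R.roots, ∀ mm : ℤ, ⟪α, v⟫ + (mm : ℝ) ≠ 0}

/-- A positive affine root `a = (α,m)`: `α ∈ Σ₀` and either `m > 0`, or `m = 0` and
`α ∈ Σ₀⁺`. -/
def IsPosAffine {V : Type*} [NormedAddCommGroup V] [InnerProductSpace ℝ V]
    [FiniteDimensional ℝ V] (R : RootSystemBase V) (a : V × ℤ) : Prop :=
  a.1 ∈ R.roots ∧ (0 < a.2 ∨ (a.2 = 0 ∧ a.1 ∈ R.pos))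

/-- The affine reflection `s_a(v) = v − (α(v)+m)·α∨` associated to `a = (α,m)`. -/
def affRefl {V : Type*} [NormedAddCommGroup V] [InnerProductSpace ℝ V]
    (a : V × ℤ) (v : V) : V :=
  v - (⟪a.1, v⟫ + (a.2 : ℝ)) • coroot a.1

/-- The Dunkl-type operator:
`(D_u^k f)(v) = (∂_u f)(v) + Σ k_α α(u) f(s_a(v))`, the (finite) sum running over the
positive affine roots `a = (α,m)` with `α(v) + m < 0`. -/
def dunkl {V : Type*} [NormedAddCommGroup V] [InnerProductSpace ℝ V]
    [FiniteDimensional ℝ V] (R : RootSystemBase V) (k : V → ℝ)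
    (u : V) (f : V → ℂ) (v : V) : ℂ :=
  fderiv ℝ f v u +
    ∑ᶠ a ∈ {a : V × ℤ | IsPosAffine R a ∧ ⟪a.1, v⟫ + (a.2 : ℝ) < 0},
      ((k a.1 * ⟪a.1, u⟫ : ℝ) : ℂ) * f (affRefl a v)

end

noncomputable section

section Reflection

variable {V : Type*} [NormedAddCommGroup V] [InnerProductSpace ℝ V]

theorem inner_coroot_self {α : V} (hα : α ≠ 0) : ⟪α, coroot α⟫ = 2 := by
  have h : ‖α‖ ≠ 0 := norm_ne_zero_iff.mpr hα
  rw [coroot, inner_smul_right, real_inner_self_eq_norm_sq]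
  field_simp

theorem coroot_neg (α : V) : coroot (-α) = -coroot α := by
  simp [coroot]

theorem sRefl_eq_sub_smul (α ξ : V) : sRefl α ξ = ξ - ⟪ξ, coroot α⟫ • α := by
  simp only [sRefl, coroot, inner_smul_right, smul_smul, real_inner_comm α ξ, mul_comm]

theorem sRefl_neg_left (α ξ : V) : sRefl (-α) ξ = sRefl α ξ := by
  simp [sRefl, coroot_neg]

theorem sRefl_neg_right (α ξ : V) : sRefl α (-ξ) = -sRefl α ξ := by
  simp only [sRefl, inner_neg_right, neg_smul]
  abel

theorem sRefl_self {α : V} (hα : α ≠ 0) : sRefl α α = -α := by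
  rw [sRefl_eq_sub_smul, inner_coroot_self hα, two_smul]
  abel

theorem sRefl_sRefl {α : V} (hα : α ≠ 0) (ξ : V) : sRefl α (sRefl α ξ) = ξ := by
  have h := inner_coroot_self hα
  simp only [sRefl, inner_sub_right, inner_smul_right, h]
  module

theorem inner_sRefl_left (α ξ η : V) : ⟪sRefl α ξ, η⟫ = ⟪ξ, sRefl α η⟫ := by
  simp only [sRefl, coroot, inner_sub_left, inner_sub_right, inner_smul_left, inner_smul_right,
    real_inner_comm α ξ, conj_trivial]
  ring

theorem norm_sq_sRefl {α : V} (hα : α ≠ 0) (ξ : V) : ‖sRefl α ξ‖ ^ 2 = ‖ξ‖ ^ 2 := by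
  rw [← real_inner_self_eq_norm_sq, inner_sRefl_left, sRefl_sRefl hα, real_inner_self_eq_norm_sq]

/-- The orthogonal reflection in a nonzero vector, as a linear automorphism. -/
def sReflEquiv (α : V) (hα : α ≠ 0) : V ≃ₗ[ℝ] V :=
  LinearEquiv.ofInvolutive
    { toFun := sRefl α
      map_add' := fun x y => by
        simp only [sRefl, inner_add_right]
        module
      map_smul' := fun c x => by
        simp only [sRefl, inner_smul_right, RingHom.id_apply]
        module }
    (sRefl_sRefl hα)

theorem sReflEquiv_apply (α : V) (hα : α ≠ 0) (ξ : V) : sReflEquiv α hα ξ = sRefl α ξ := rfl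

theorem coroot_sRefl {α : V} (hα : α ≠ 0) (ξ : V) : coroot (sRefl α ξ) = sRefl α (coroot ξ) := by
  rw [coroot, norm_sq_sRefl hα, coroot, ← sReflEquiv_apply α hα, ← sReflEquiv_apply α hα, map_smul]

theorem affRefl_eq_sRefl_sub (a : V × ℤ) (v : V) :
    affRefl a v = sRefl a.1 v - (a.2 : ℝ) • coroot a.1 := by
  simp only [affRefl, sRefl]
  module

theorem affRefl_affRefl {a : V × ℤ} (ha : a.1 ≠ 0) (v : V) : affRefl a (affRefl a v) = v := by
  have h := inner_coroot_self ha
  simp only [affRefl, inner_sub_right, inner_smul_right, h]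
  module

theorem eval_affRefl_self {a : V × ℤ} (ha : a.1 ≠ 0) (v : V) :
    ⟪a.1, affRefl a v⟫ + (a.2 : ℝ) = -(⟪a.1, v⟫ + (a.2 : ℝ)) := by
  rw [affRefl, inner_sub_right, inner_smul_right, inner_coroot_self ha]
  ring

theorem fderiv_comp_affRefl [FiniteDimensional ℝ V] {a : V × ℤ} (ha : a.1 ≠ 0) (f : V → ℂ)
    (u v : V) :
    fderiv ℝ (fun x => f (affRefl a x)) v (sRefl a.1 u) = fderiv ℝ f (affRefl a v) u := by
  let e : V ≃L[ℝ] V := (sReflEquiv a.1 ha).toContinuousLinearEquiv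
  have he : ∀ x, e x = sRefl a.1 x := fun _ => rfl
  have hfun : (fun x => f (affRefl a x)) = (fun y => f (y - (a.2 : ℝ) • coroot a.1)) ∘ e := by
    funext x
    simp only [Function.comp_apply, he, affRefl_eq_sRefl_sub]
  rw [hfun, e.comp_right_fderiv, fderiv_comp_sub, ContinuousLinearMap.comp_apply,
    ContinuousLinearEquiv.coe_coe, he, he, sRefl_sRefl ha, affRefl_eq_sRefl_sub]

/-- The action of the affine reflection `s_a` on affine roots, `b ↦ b ∘ s_a`. -/
def affAct (a b : V × ℤ) : V × ℤ :=
  (sRefl a.1 b.1, b.2 - a.2 * ⌊⟪b.1, coroot a.1⟫⌋)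

end Reflection

namespace RootSystemBase

variable {V : Type*} [NormedAddCommGroup V] [InnerProductSpace ℝ V] [FiniteDimensional ℝ V]
  (R : RootSystemBase V)

theorem neg_mem {α : V} (hα : α ∈ R.roots) : -α ∈ R.roots := by
  simpa only [sRefl_self (R.ne_zero α hα)] using R.refl_mem α hα α hα

theorem floor_inner_coroot {α β : V} (hα : α ∈ R.roots) (hβ : β ∈ R.roots) :
    (⌊⟪β, coroot α⟫⌋ : ℝ) = ⟪β, coroot α⟫ := by
  obtain ⟨m, hm⟩ := R.crystallographic α hα β hβ
  rw [hm, Int.floor_intCast]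

theorem neg_mem_pos {α : V} (hα : α ∈ R.roots) (h : α ∉ R.pos) : -α ∈ R.pos := by
  rcases R.pos_or_neg α hα with h' | h'
  · exact absurd h'.1 h
  · exact h'.2

theorem neg_notMem_pos {α : V} (h : α ∈ R.pos) : -α ∉ R.pos := by
  rcases R.pos_or_neg α (R.pos_sub h) with h' | h'
  · exact h'.2
  · exact absurd h h'.1

/-- Being a nonnegative linear combination of simple roots. -/
def IsNonnegCombo (x : V) : Prop :=
  ∃ c : V → ℝ, (∀ β, 0 ≤ c β) ∧ x = ∑ β ∈ R.simples, c β • β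

variable {R}

theorem IsNonnegCombo.add {x y : V} (hx : R.IsNonnegCombo x) (hy : R.IsNonnegCombo y) :
    R.IsNonnegCombo (x + y) := by
  obtain ⟨c, hc, rfl⟩ := hx
  obtain ⟨d, hd, rfl⟩ := hy
  refine ⟨c + d, fun β => add_nonneg (hc β) (hd β), ?_⟩
  simp only [Pi.add_apply, add_smul, Finset.sum_add_distrib]

theorem IsNonnegCombo.smul {x : V} (hx : R.IsNonnegCombo x) {t : ℝ} (ht : 0 ≤ t) :
    R.IsNonnegCombo (t • x) := by
  obtain ⟨c, hc, rfl⟩ := hx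
  refine ⟨fun β => t * c β, fun β => mul_nonneg ht (hc β), ?_⟩
  simp only [Finset.smul_sum, smul_smul]

variable (R)

theorem exists_coord {γ : V} (hγ : γ ∈ R.simples) :
    ∃ l : V →ₗ[ℝ] ℝ, ∀ c : V → ℝ, l (∑ β ∈ R.simples, c β • β) = c γ := by
  obtain ⟨L, hL⟩ := LinearMap.exists_leftInverse_of_injective
    (Finsupp.linearCombination ℝ (fun β : {x // x ∈ R.simples} => (β : V)))
    (LinearMap.ker_eq_bot.mpr R.simples_indep)
  have hLs : ∀ β : {x // x ∈ R.simples}, L β = Finsupp.single β 1 := fun β => by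
    simpa using LinearMap.congr_fun hL (Finsupp.single β 1)
  refine ⟨(Finsupp.lapply ⟨γ, hγ⟩).comp L, fun c => ?_⟩
  classical
  rw [← Finset.sum_coe_sort]
  simp [hLs, Finsupp.single_apply]

theorem eq_zero_of_isNonnegCombo {x : V} (hx : R.IsNonnegCombo x) (hx' : R.IsNonnegCombo (-x)) :
    x = 0 := by
  obtain ⟨c, hc, hxc⟩ := hx
  obtain ⟨d, hd, hxd⟩ := hx'
  rw [hxc]
  refine Finset.sum_eq_zero fun γ hγ => ?_
  obtain ⟨l, hl⟩ := R.exists_coord hγ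
  have h1 : l x = c γ := by rw [hxc, hl]
  have h2 : l (-x) = d γ := by rw [hxd, hl]
  rw [map_neg] at h2
  have h0 : c γ = 0 := by linarith [hc γ, hd γ]
  rw [h0, zero_smul]

theorem sRefl_simple_mem_pos {β α : V} (hβ : β ∈ R.simples) (hα : α ∈ R.pos) (hne : α ≠ β) :
    sRefl β α ∈ R.pos := by
  by_contra hn
  have hβr := R.simples_sub hβ
  have hαr := R.pos_sub hα
  obtain ⟨d, hd, hdsum⟩ := R.pos_combo _ (R.neg_mem_pos (R.refl_mem β hβr α hαr) hn)
  obtain ⟨c, hc, hcsum⟩ := R.pos_combo α hα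
  have hzero : ∀ γ ∈ R.simples, γ ≠ β → c γ = 0 := by
    intro γ hγ hγβ
    obtain ⟨l, hl⟩ := R.exists_coord hγ
    have h1 : l α = c γ := by rw [hcsum, hl]
    have h2 : l (-sRefl β α) = d γ := by rw [hdsum, hl]
    have h3 : l β = 0 := by
      classical
      have := hl (Pi.single β 1)
      simpa [Pi.single_apply, ite_smul, hβ, hγβ] using this
    rw [sRefl_eq_sub_smul, map_neg, map_sub, map_smul, h3, h1, smul_zero] at h2
    linarith [hc γ, hd γ]
  have hαβ : α = c β • β := by
    rw [hcsum]
    exact Finset.sum_eq_single_of_mem β hβ fun γ hγ hγβ => by rw [hzero γ hγ hγβ, zero_smul]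
  rcases R.reduced β hβr (c β) (hαβ ▸ hαr) with h | h
  · exact hne (by rw [hαβ, h, one_smul])
  · linarith [hc β]

theorem inner_coroot_hroot_nonneg {α : V} (hα : α ∈ R.pos) : 0 ≤ ⟪α, coroot R.hroot⟫ := by
  have hφ := R.pos_sub R.hroot_pos
  have hαr := R.pos_sub hα
  obtain ⟨n, hn⟩ := R.crystallographic _ hφ α hαr
  rw [hn]
  by_contra! hlt
  have hn1 : (n : ℝ) ≤ -1 := by
    have : n < 0 := by exact_mod_cast hlt
    exact_mod_cast (by omega : n ≤ -1)
  have h1 : R.IsNonnegCombo (R.hroot - sRefl R.hroot α) :=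
    R.hroot_highest _ (R.refl_mem _ hφ α hαr)
  have h2 : R.IsNonnegCombo ((-1 - (n : ℝ)) • R.hroot) :=
    IsNonnegCombo.smul (R.pos_combo _ R.hroot_pos) (by linarith)
  have h3 := h1.add h2
  rw [sRefl_eq_sub_smul, hn] at h3
  refine R.ne_zero α hαr (R.eq_zero_of_isNonnegCombo (R.pos_combo α hα) ?_)
  convert h3 using 1
  module

theorem inner_coroot_hroot_le_one {α : V} (hα : α ∈ R.roots) (hne : α ≠ R.hroot) :
    ⟪α, coroot R.hroot⟫ ≤ 1 := by
  have hφ := R.pos_sub R.hroot_pos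
  obtain ⟨n, hn⟩ := R.crystallographic _ hφ α hα
  rw [hn]
  by_contra! hlt
  have hn2 : (2 : ℝ) ≤ n := by
    have : 1 < n := by exact_mod_cast hlt
    exact_mod_cast (by omega : 2 ≤ n)
  have h1 : R.IsNonnegCombo (R.hroot - -sRefl R.hroot α) :=
    R.hroot_highest _ (R.neg_mem (R.refl_mem _ hφ α hα))
  have h2 : R.IsNonnegCombo (((n : ℝ) - 2) • R.hroot) :=
    IsNonnegCombo.smul (R.pos_combo _ R.hroot_pos) (by linarith)
  have h3 := h1.add h2
  rw [sRefl_eq_sub_smul, hn] at h3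
  refine hne (sub_eq_zero.mp (R.eq_zero_of_isNonnegCombo ?_ ?_))
  · convert h3 using 1
    module
  · rw [neg_sub]
    exact R.hroot_highest α hα

/-- A simple affine root: `(β, 0)` with `β` simple, or `(-φ, 1)` with `φ` the highest root. -/
def IsSimpleAffine (a : V × ℤ) : Prop :=
  (a.2 = 0 ∧ a.1 ∈ R.simples) ∨ (a.1 = -R.hroot ∧ a.2 = 1)

variable {R}

theorem IsSimpleAffine.isPosAffine {a : V × ℤ} (ha : R.IsSimpleAffine a) : IsPosAffine R a := by
  rcases ha with ⟨h0, hs⟩ | ⟨h1, h2⟩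
  · exact ⟨R.simples_sub hs, Or.inr ⟨h0, R.simples_sub_pos hs⟩⟩
  · refine ⟨h1 ▸ R.neg_mem (R.pos_sub R.hroot_pos), Or.inl (by omega)⟩

theorem isPosAffine_affAct {a b : V × ℤ} (ha : R.IsSimpleAffine a) (hb : IsPosAffine R b)
    (hne : b ≠ a) : IsPosAffine R (affAct a b) := by
  refine ⟨R.refl_mem _ ha.isPosAffine.1 _ hb.1, ?_⟩
  obtain ⟨β, i⟩ := a
  obtain ⟨α, m⟩ := b
  obtain ⟨hα, hm⟩ := hb
  simp only [affAct] at hα hm ⊢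
  rcases ha with ⟨h0, hs⟩ | ⟨h1, h2⟩
  · simp only at h0 hs
    subst h0
    rw [zero_mul, sub_zero]
    rcases hm with hm | ⟨rfl, hp⟩
    · exact Or.inl hm
    · exact Or.inr ⟨rfl, R.sRefl_simple_mem_pos hs hp fun h => hne (by rw [h])⟩
  · simp only at h1 h2
    subst h1 h2
    have hφ := R.pos_sub R.hroot_pos
    obtain ⟨n, hn⟩ := R.crystallographic _ hφ α hα
    have hfl : m - 1 * ⌊⟪α, coroot (-R.hroot)⟫⌋ = m + n := by
      rw [coroot_neg, inner_neg_right, hn, ← Int.cast_neg, Int.floor_intCast]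
      ring
    rw [hfl, sRefl_neg_left]
    rcases hm with hm | ⟨rfl, hp⟩
    · by_cases hαφ : α = -R.hroot
      · subst hαφ
        rw [inner_neg_left, inner_coroot_self (R.ne_zero _ hφ)] at hn
        have hn2 : n = -2 := by exact_mod_cast hn.symm
        have hm1 : m ≠ 1 := fun h => hne (by rw [h])
        rw [sRefl_neg_right, sRefl_self (R.ne_zero _ hφ), neg_neg]
        have hcase : 0 < m + n ∨ m + n = 0 := by omega
        exact hcase.imp_right fun h => ⟨h, R.hroot_pos⟩
      · have hle := R.inner_coroot_hroot_le_one (R.neg_mem hα)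
          fun h => hαφ (by rw [← h, neg_neg])
        rw [inner_neg_left, hn] at hle
        have hn1 : -1 ≤ n := by
          have : -n ≤ 1 := by exact_mod_cast hle
          omega
        have hcase : 0 < m + n ∨ (m + n = 0 ∧ n = -1) := by omega
        refine hcase.imp_right fun h => ⟨h.1, ?_⟩
        by_contra hnp
        have h0 := R.inner_coroot_hroot_nonneg (R.neg_mem_pos (R.refl_mem _ hφ α hα) hnp)
        rw [sRefl_eq_sub_smul, hn, inner_neg_left, inner_sub_left, inner_smul_left,
          inner_coroot_self (R.ne_zero _ hφ), hn, h.2] at h0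
        norm_num at h0
    · have h0 := R.inner_coroot_hroot_nonneg hp
      rw [hn] at h0
      have hn0 : 0 ≤ n := by exact_mod_cast h0
      rcases hn0.lt_or_eq with h | h
      · exact Or.inl (by omega)
      · refine Or.inr ⟨by omega, ?_⟩
        rw [sRefl_eq_sub_smul, hn, ← h, Int.cast_zero, zero_smul, sub_zero]
        exact hp

variable (R)

theorem eval_affAct {a b : V × ℤ} (ha : a.1 ∈ R.roots) (hb : b.1 ∈ R.roots) (v : V) :
    ⟪(affAct a b).1, v⟫ + ((affAct a b).2 : ℝ) = ⟪b.1, affRefl a v⟫ + (b.2 : ℝ) := by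
  simp only [affAct, Int.cast_sub, Int.cast_mul, R.floor_inner_coroot ha hb,
    affRefl_eq_sRefl_sub, inner_sub_right, inner_smul_right, inner_sRefl_left]
  ring

theorem affAct_affAct {a b : V × ℤ} (ha : a.1 ∈ R.roots) (hb : b.1 ∈ R.roots) :
    affAct a (affAct a b) = b := by
  have h0 := R.ne_zero _ ha
  have hneg : ⟪sRefl a.1 b.1, coroot a.1⟫ = -⟪b.1, coroot a.1⟫ := by
    rw [inner_sRefl_left, ← coroot_sRefl h0, sRefl_self h0, coroot_neg, inner_neg_right]
  obtain ⟨n, hn⟩ := R.crystallographic _ ha _ hb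
  refine Prod.ext (sRefl_sRefl h0 _) ?_
  simp only [affAct, hneg, hn, ← Int.cast_neg, Int.floor_intCast]
  ring

theorem affAct_ne {a b : V × ℤ} (ha : IsPosAffine R a) (hb : IsPosAffine R b) :
    affAct a b ≠ a := by
  intro h
  have h0 := R.ne_zero _ ha.1
  have hb' : b = affAct a a := by
    rw [← R.affAct_affAct ha.1 hb.1, h]
  have h1 : b.1 = -a.1 := by rw [hb', affAct, sRefl_self h0]
  have h2 : b.2 = -a.2 := by
    rw [hb', affAct, inner_coroot_self h0]
    norm_num
    ring
  rcases ha.2 with ha | ⟨ha0, hap⟩ <;> rcases hb.2 with hb | ⟨hb0, hbp⟩ <;> try omega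
  exact R.neg_notMem_pos hap (h1 ▸ hbp)

theorem affRefl_comp {a b : V × ℤ} (ha : a.1 ∈ R.roots) (hb : b.1 ∈ R.roots) (v : V) :
    affRefl a (affRefl (affAct a b) v) = affRefl b (affRefl a v) := by
  have h0 := R.ne_zero _ ha
  rw [affRefl_eq_sRefl_sub a (affRefl _ v), affRefl, R.eval_affAct ha hb]
  simp only [affAct]
  rw [← sReflEquiv_apply a.1 h0, map_sub, map_smul, sReflEquiv_apply, sReflEquiv_apply,
    coroot_sRefl h0, sRefl_sRefl h0, affRefl.eq_1 b, affRefl_eq_sRefl_sub a v]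
  abel

theorem multiplicity_sRefl {k : V → ℝ} (hk : IsMultiplicity R k) {α β : V} (hα : α ∈ R.roots)
    (hβ : β ∈ R.roots) : k (sRefl α β) = k β :=
  hk.2 (sReflEquiv α (R.ne_zero α hα)) (Subgroup.subset_closure ⟨α, hα, fun _ => rfl⟩) β hβ

/-- The positive affine roots that are negative at `v`. -/
def negAt (v : V) : Set (V × ℤ) :=
  {a | IsPosAffine R a ∧ ⟪a.1, v⟫ + (a.2 : ℝ) < 0}

theorem finite_negAt (v : V) : (R.negAt v).Finite := by
  refine (R.roots.finite_toSet.biUnion fun α _ =>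
    (Set.finite_singleton α).prod (Set.finite_Icc (0 : ℤ) ⌊-⟪α, v⟫⌋)).subset ?_
  rintro ⟨α, m⟩ ⟨⟨hα, hm⟩, hlt⟩
  simp only [Set.mem_iUnion]
  refine ⟨α, hα, rfl, ?_, Int.le_floor.mpr ?_⟩
  · rcases hm with hm | hm
    · exact hm.le
    · exact hm.1.ge
  · simp only at hlt ⊢
    linarith

theorem affAct_bijOn {a : V × ℤ} (ha : R.IsSimpleAffine a) (v : V) :
    Set.BijOn (affAct a) (R.negAt (affRefl a v) \ {a}) (R.negAt v \ {a}) := by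
  have hpos := ha.isPosAffine
  have h0 := R.ne_zero _ hpos.1
  have hmaps : ∀ w, Set.MapsTo (affAct a) (R.negAt (affRefl a w) \ {a}) (R.negAt w \ {a}) :=
    fun w b ⟨⟨hb, hlt⟩, hne⟩ => ⟨⟨isPosAffine_affAct ha hb hne, by
      rwa [R.eval_affAct hpos.1 hb.1]⟩, R.affAct_ne hpos hb⟩
  have hback := hmaps (affRefl a v)
  rw [affRefl_affRefl h0] at hback
  exact Set.InvOn.bijOn ⟨fun b hb => R.affAct_affAct hpos.1 hb.1.1.1,
    fun b hb => R.affAct_affAct hpos.1 hb.1.1.1⟩ (hmaps v) hback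

open Classical in
theorem finsum_negAt (g : V × ℤ → ℂ) {a : V × ℤ} (ha : IsPosAffine R a) (v : V) :
    ∑ᶠ b ∈ R.negAt v, g b =
      (if ⟪a.1, v⟫ + (a.2 : ℝ) < 0 then g a else 0) + ∑ᶠ b ∈ R.negAt v \ {a}, g b := by
  split_ifs with h
  · have hmem : a ∈ R.negAt v := ⟨ha, h⟩
    rw [← finsum_mem_insert g (fun h' : a ∈ R.negAt v \ {a} => h'.2 rfl) ((R.finite_negAt v).subset Set.sdiff_subset),
      Set.insert_sdiff_singleton, Set.insert_eq_of_mem hmem]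
  · have hmem : a ∉ R.negAt v := fun h' => h h'.2
    rw [Set.sdiff_singleton_eq_self hmem, zero_add]

end RootSystemBase

/-- For a simple affine root `a` (either `a = (β,0)` with `β` simple,
or `a = (−φ,1)`), every `f` smooth on `V_reg`, every `u ∈ V` and every `v ∈ V_reg`, the
Dunkl-type operators satisfy the cross relation
`(D_u^k f)(s_a(v)) = (D_{u−β(u)β∨}^k (f∘s_a))(v) + k_β β(u) f(v)`, where `β = Da`. -/
theorem statement17
    {V : Type*} [NormedAddCommGroup V] [InnerProductSpace ℝ V] [FiniteDimensional ℝ V]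
    (R : RootSystemBase V) (k : V → ℝ) (hk : IsMultiplicity R k)
    (a : V × ℤ)
    (ha : (a.2 = 0 ∧ a.1 ∈ R.simples) ∨ (a.1 = -R.hroot ∧ a.2 = 1))
    (f : V → ℂ) (hf : ContDiffOn ℝ (⊤ : ℕ∞) f (VregSet R))
    (u v : V) (hv : v ∈ VregSet R) :
    dunkl R k u f (affRefl a v) =
      dunkl R k (u - ⟪a.1, u⟫ • coroot a.1) (fun x => f (affRefl a x)) v +
        ((k a.1 * ⟪a.1, u⟫ : ℝ) : ℂ) * f v := by
  have hs : R.IsSimpleAffine a := ha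
  have hpos := hs.isPosAffine
  have h0 := R.ne_zero _ hpos.1
  have hreg := hv _ hpos.1 a.2
  have hu : u - ⟪a.1, u⟫ • coroot a.1 = sRefl a.1 u := rfl
  have hinner : ⟪a.1, sRefl a.1 u⟫ = -⟪a.1, u⟫ := by
    rw [← inner_sRefl_left, sRefl_self h0, inner_neg_left]
  have hsum : ∑ᶠ b ∈ R.negAt (affRefl a v) \ {a},
        ((k b.1 * ⟪b.1, u⟫ : ℝ) : ℂ) * f (affRefl b (affRefl a v)) =
      ∑ᶠ b ∈ R.negAt v \ {a},
        ((k b.1 * ⟪b.1, sRefl a.1 u⟫ : ℝ) : ℂ) * f (affRefl a (affRefl b v)) := by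
    refine finsum_mem_eq_of_bijOn (affAct a) (R.affAct_bijOn hs v) fun b hb => ?_
    have hb' : b.1 ∈ R.roots := hb.1.1.1
    rw [R.affRefl_comp hpos.1 hb']
    simp only [affAct]
    rw [R.multiplicity_sRefl hk hpos.1 hb', inner_sRefl_left, sRefl_sRefl h0]
  have hL := R.finsum_negAt
    (fun b => ((k b.1 * ⟪b.1, u⟫ : ℝ) : ℂ) * f (affRefl b (affRefl a v))) hpos (affRefl a v)
  have hR := R.finsum_negAt
    (fun b => ((k b.1 * ⟪b.1, sRefl a.1 u⟫ : ℝ) : ℂ) * f (affRefl a (affRefl b v))) hpos v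
  simp only [RootSystemBase.negAt] at hL hR hsum
  rw [dunkl, dunkl, hu, fderiv_comp_affRefl h0, hL, hR, hsum, eval_affRefl_self h0,
    affRefl_affRefl h0, hinner]
  rcases lt_or_gt_of_ne hreg with h | h
  · rw [if_neg (by linarith), if_pos h]
    push_cast
    ring
  · rw [if_pos (by linarith), if_neg (by linarith)]
    ring

end
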